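/- Let G be a group and I a type. Suppose given, for every pair (i,j) ∈ I × I, a bijection λ_{ij} : G → G with λ_{ii} = id_G for all i, and, for every triple (i,j,k) ∈ I × I × I, an element g_{ijk} ∈ G with g_{iij} = 1 and g_{ijj} = 1 for all i,j. Consider the Čech-type product on I × I × G given by (i,j,a) · (j,k,b) := (i,k, g_{ijk} · λ_{jk}^{-1}(a) · b). Then this product is associative — i.e. ((i,j,a)·(j,k,b))·(k,l,c) = (i,j,a)·((j,k,b)·(k,l,c)) for all i,j,k,l ∈ I and all a,b,c ∈ G — if and only if the following three conditions hold: (i) every λ_{ij} is a group automorphism of G; (ii) λ_{ij} ∘ λ_{jk} = λ_{ik} ∘ AD_{g_{ijk}} (equivalently, λ_{ij} ∘ λ_{jk} = AD_{λ_{ik}(g_{ijk})} ∘ λ_{ik}) for all i,j,k ∈ I; (iii) g_{ijl} · g_{jkl} = g_{ikl} · λ_{kl}^{-1}(g_{ijk}) for all i,j,k,l ∈ I. Moreover, when these conditions hold, the elements (i,i,1) are two-sided units and every (i,j,a) is invertible, so that I × I × G is the set of morphisms of a groupoid with set of objects I. -/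

import Mathlib

/-- The third component of the Čech-type product on `I × I × G` associated with the
data `(λ, g)`: the product `(i,j,a) · (j,k,b) := (i,k, g i j k * (λ j k)⁻¹ a * b)`. -/
def cechMul {G : Type*} [Group G] {I : Type*} (lam : I → I → G ≃ G)
    (g : I → I → I → G) (i j k : I) (a b : G) : G :=
  g i j k * (lam j k).symm a * b

theorem stmt_0 {G : Type*} [Group G] {I : Type*}
    (lam : I → I → G ≃ G) (hlam : ∀ i, lam i i = Equiv.refl G)
    (g : I → I → I → G) (hg₁ : ∀ i j, g i i j = 1) (hg₂ : ∀ i j, g i j j = 1) :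
    ((∀ (i j k l : I) (a b c : G),
        cechMul lam g i k l (cechMul lam g i j k a b) c
          = cechMul lam g i j l a (cechMul lam g j k l b c)) ↔
      ((∀ (i j : I) (a b : G), lam i j (a * b) = lam i j a * lam i j b) ∧
       (∀ (i j k : I) (x : G), lam i j (lam j k x) = lam i k (g i j k * x * (g i j k)⁻¹)) ∧
       (∀ i j k l : I, g i j l * g j k l = g i k l * (lam k l).symm (g i j k))))
    ∧
    (((∀ (i j : I) (a b : G), lam i j (a * b) = lam i j a * lam i j b) ∧
      (∀ (i j k : I) (x : G), lam i j (lam j k x) = lam i k (g i j k * x * (g i j k)⁻¹)) ∧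
      (∀ i j k l : I, g i j l * g j k l = g i k l * (lam k l).symm (g i j k))) →
      ∀ (i j : I) (a : G),
        cechMul lam g i i j 1 a = a ∧
        cechMul lam g i j j a 1 = a ∧
        ∃ b : G, cechMul lam g i j i a b = 1 ∧ cechMul lam g j i j b a = 1) := by
  have symm_mul : (∀ (i j : I) (a b : G), lam i j (a * b) = lam i j a * lam i j b) →
      ∀ (i j : I) (a b : G),
        (lam i j).symm (a * b) = (lam i j).symm a * (lam i j).symm b := by
    intro h i j a b
    rw [Equiv.symm_apply_eq, h]
    simp
  have key : (∀ (i j k : I) (x : G),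
        lam i j (lam j k x) = lam i k (g i j k * x * (g i j k)⁻¹)) →
      ∀ (j k l : I) (a : G),
        (lam j l).symm a * g j k l = g j k l * (lam k l).symm ((lam j k).symm a) := by
    intro h j k l a
    have h1 := h j k l ((lam k l).symm ((lam j k).symm a))
    simp only [Equiv.apply_symm_apply] at h1
    have h2 : (lam j l).symm a = _ := (Equiv.symm_apply_eq _).2 h1
    rw [h2]
    group
  refine ⟨⟨fun H => ?_, ?_⟩, ?_⟩
  · simp only [cechMul] at H
    have hm : ∀ (i j : I) (a b : G),
        (lam i j).symm (a * b) = (lam i j).symm a * (lam i j).symm b := by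
      intro i l a b
      simpa [hlam, hg₁] using H i i i l a b 1
    have hone : ∀ i j : I, (lam i j).symm 1 = 1 := by
      intro i j
      simpa using hm i j 1 1
    have h3 : ∀ i j k l : I, g i j l * g j k l = g i k l * (lam k l).symm (g i j k) := by
      intro i j k l
      simpa [hone] using (H i j k l 1 1 1).symm
    refine ⟨?_, ?_, h3⟩
    · intro i j a b
      rw [← Equiv.eq_symm_apply, hm]
      simp
    · intro j k l x
      rw [← Equiv.symm_apply_eq]
      have h := H j j k l (lam j k (lam k l x)) 1 1
      simp [hg₁, hone] at h
      rw [eq_mul_inv_iff_mul_eq, h]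
  · rintro ⟨h1, h2, h3⟩ i j k l a b c
    simp only [cechMul, symm_mul h1]
    have h4 := key h2 j k l a
    calc _ = (g i k l * (lam k l).symm (g i j k)) *
          (lam k l).symm ((lam j k).symm a) * (lam k l).symm b * c := by group
      _ = g i j l * (g j k l * (lam k l).symm ((lam j k).symm a)) * (lam k l).symm b * c := by
          rw [← h3]; group
      _ = _ := by rw [← h4]; group
  · rintro ⟨h1, h2, h3⟩ i j a
    have hm := symm_mul h1
    have hone : ∀ i j : I, (lam i j).symm 1 = 1 := by
      intro i j
      simpa using hm i j 1 1
    refine ⟨by simp [cechMul, hg₁, hone], by simp [cechMul, hg₂, hlam],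
      (g i j i * (lam j i).symm a)⁻¹, by simp [cechMul], ?_⟩
    have hinv : ∀ x, (lam i j).symm x⁻¹ = ((lam i j).symm x)⁻¹ := by
      intro x
      rw [eq_inv_iff_mul_eq_one, ← hm]
      simp [hone]
    have h4 := key h2 j i j a
    have h5 := h3 i j i j
    simp only [hg₁, hg₂, one_mul] at h5
    simp only [hlam, Equiv.refl_symm, Equiv.refl_apply] at h4
    simp only [cechMul, hinv, hm]
    rw [← h5, ← h4]
    group
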